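/- For every integer n ≥ 3, defining s(i) = f((i−1)/n + 1/(8n)) for i ∈ {1, …, n}, it holds that (1/n)·∑_{i=1}^{n} s(i) ≤ F(1) − 1/(52n). -/

import Mathlib

open Real

noncomputable def R : ℝ := 1 / (1 + Real.log 2)

noncomputable def f (x : ℝ) : ℝ :=
  if x ≤ R then 1/2 else (2 * Real.exp 1) ^ (x - 1)

noncomputable def F (x : ℝ) : ℝ :=
  if x ≤ R then x/2 else R * (2 * Real.exp 1) ^ (x - 1)

noncomputable def P (c : ℝ) : ℝ := ∫ y in (0:ℝ)..1, min (f y) c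

noncomputable def Q (c : ℝ) : ℝ := ∫ y in (0:ℝ)..1, max (c - f y) 0

noncomputable def xic : ℝ := (1 + (2/3) * Real.log (4/3)) * R - 2/3

noncomputable def phi : ℝ := (2/3) * xic / (2/3 - R + xic)

noncomputable def xi (x : ℝ) : ℝ :=
  if x ≤ 1/3 then xic / x else 9 * xic * (1 - 2 * x)

noncomputable def T (a b : ℝ) : ℝ := (a + b - 1/2) * (xi b - xi a)

noncomputable def pile (x : ℝ) : ℝ := max (2/3) (2 * x)

theorem f_eq_max (x : ℝ) : f x = max (1 / 2) (exp ((1 + log 2) * (x - 1))) := by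
  have hl : 0 < log 2 := log_pos (by norm_num)
  have hpow : (2 * exp 1) ^ (x - 1) = exp ((1 + log 2) * (x - 1)) := by
    rw [rpow_def_of_pos (by positivity), log_mul (by norm_num) (exp_ne_zero 1), log_exp,
      add_comm (log 2)]
  have hhalf : (1 / 2 : ℝ) = exp (-log 2) := by
    rw [exp_neg, exp_log (by norm_num)]; norm_num
  unfold f
  split_ifs with h
  · rw [R, le_div_iff₀ (by linarith)] at h
    rw [max_eq_left]
    rw [hhalf, exp_le_exp]
    linarith
  · rw [R, not_le, div_lt_iff₀ (by linarith)] at h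
    rw [hpow, max_eq_right]
    rw [hhalf, exp_le_exp]
    linarith

theorem continuous_f : Continuous f := by
  rw [funext f_eq_max]
  fun_prop

theorem exists_subgradient_f (x : ℝ) : ∃ m, ∀ y, f x + m * (y - x) ≤ f y := by
  simp only [f_eq_max]
  rcases le_total (exp ((1 + log 2) * (x - 1))) (1 / 2) with h | h
  · exact ⟨0, fun y => by rw [max_eq_left h]; simp⟩
  · refine ⟨(1 + log 2) * exp ((1 + log 2) * (x - 1)), fun y => ?_⟩
    rw [max_eq_right h]
    refine le_trans ?_ (le_max_right _ _)
    have hy : (1 + log 2) * (y - 1) = (1 + log 2) * (x - 1) + (1 + log 2) * (y - x) := by ring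
    rw [hy, exp_add]
    nlinarith [exp_pos ((1 + log 2) * (x - 1)), add_one_le_exp ((1 + log 2) * (y - x))]

theorem R_pos : 0 < R := by
  have hl : 0 < log 2 := log_pos (by norm_num)
  unfold R
  positivity

theorem R_lt_one : R < 1 := by
  have hl : 0 < log 2 := log_pos (by norm_num)
  rw [R, div_lt_one (by linarith)]
  linarith

theorem F_one : F 1 = R := by
  simp [F, not_le.mpr R_lt_one]

theorem integral_f : ∫ y in (0 : ℝ)..1, f y = R := by
  have hl : 0 < log 2 := log_pos (by norm_num)
  have ha : 1 + log 2 ≠ 0 := by positivity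
  have hR : (1 + log 2) * R = 1 := by rw [R]; field_simp
  rw [← intervalIntegral.integral_add_adjacent_intervals
    (continuous_f.intervalIntegrable 0 R) (continuous_f.intervalIntegrable R 1)]
  have h₁ : ∫ y in (0 : ℝ)..R, f y = R / 2 := by
    rw [intervalIntegral.integral_congr (g := fun _ => (1 / 2 : ℝ))]
    · simp; ring
    · intro y hy
      rw [Set.uIcc_of_le R_pos.le] at hy
      exact if_pos hy.2
  have h₂ : ∫ y in R..1, f y = R / 2 := by
    have hF : ∀ y ∈ Set.uIcc R 1, HasDerivAt
        (fun z => exp ((1 + log 2) * (z - 1)) / (1 + log 2)) (exp ((1 + log 2) * (y - 1))) y := by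
      intro y _
      have := ((((hasDerivAt_id y).sub_const 1).const_mul (1 + log 2)).exp).div_const (1 + log 2)
      exact this.congr_deriv (by simp [ha])
    rw [intervalIntegral.integral_congr (g := fun y => exp ((1 + log 2) * (y - 1))),
      intervalIntegral.integral_eq_sub_of_hasDerivAt hF
        (Continuous.intervalIntegrable (by fun_prop) _ _)]
    · have hexp : (1 + log 2) * (R - 1) = -log 2 := by linarith
      rw [hexp, exp_neg, exp_log (by norm_num), R]
      simp
      field_simp
      norm_num
    · intro y hy
      rw [Set.uIcc_of_le R_lt_one.le] at hy
      simp only [f_eq_max]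
      rw [max_eq_right]
      calc (1 / 2 : ℝ) = exp (-log 2) := by rw [exp_neg, exp_log (by norm_num)]; norm_num
        _ ≤ _ := by
          rw [exp_le_exp]
          nlinarith [hy.1]
  rw [h₁, h₂]
  ring

theorem le_integral_f {h : ℝ} (hh : 0 ≤ h) (u : ℝ) :
    h * (f (u + h / 8) + 3 / 8 * (f (u + h / 8) - f (u + h / 8 - h))) ≤
      ∫ y in u..(u + h), f y := by
  obtain ⟨m, hm⟩ := exists_subgradient_f (u + h / 8)
  have hint : ∫ y in u..(u + h), (f (u + h / 8) + m * (y - (u + h / 8))) =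
      h * (f (u + h / 8) + 3 / 8 * (m * h)) := by
    rw [intervalIntegral.integral_add (by simp)
      (Continuous.intervalIntegrable (by fun_prop) _ _), intervalIntegral.integral_const_mul,
      intervalIntegral.integral_sub (by simp) (by simp)]
    simp
    ring
  have hmono : ∫ y in u..(u + h), (f (u + h / 8) + m * (y - (u + h / 8))) ≤
      ∫ y in u..(u + h), f y :=
    intervalIntegral.integral_mono_on (by linarith)
      (Continuous.intervalIntegrable (by fun_prop) _ _) (continuous_f.intervalIntegrable _ _)
      fun y _ => hm y
  rw [hint] at hmono
  refine le_trans (mul_le_mul_of_nonneg_left ?_ hh) hmono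
  linarith [hm (u + h / 8 - h)]

theorem lt_f_of_le {x : ℝ} (hx : 17 / 24 ≤ x) : 1 / 2 + 2 / 39 < f x := by
  have hl : log 2 < 0.6931471808 := log_two_lt_d9
  have hl₀ : 0 < log 2 := log_pos (by norm_num)
  rw [f_eq_max]
  refine lt_of_lt_of_le ?_ (le_max_right _ _)
  have h₁ : exp (2 * -((1 + log 2) * (7 / 48))) ≤ exp ((1 + log 2) * (x - 1)) := by
    rw [exp_le_exp]
    nlinarith
  refine lt_of_lt_of_le ?_ h₁
  rw [two_mul, exp_add]
  have h₂ := add_one_le_exp (-((1 + log 2) * (7 / 48)))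
  have h₃ : (0.753 : ℝ) ≤ exp (-((1 + log 2) * (7 / 48))) := by linarith
  nlinarith

theorem stmt_19 : ∀ n : ℕ, 3 ≤ n →
    (1 / n) * ∑ i ∈ Finset.Icc 1 n, f (((i : ℝ) - 1) / n + 1 / (8 * n)) ≤ F 1 - 1 / (52 * n) := by
  intro n hn
  have hn' : (3 : ℝ) ≤ n := by exact_mod_cast hn
  have hpos : (0 : ℝ) < n := by linarith
  set h : ℝ := 1 / n with hh
  have hh0 : 0 < h := by positivity
  have hnh : n * h = 1 := by rw [hh]; field_simp
  have hh3 : h ≤ 1 / 3 := one_div_le_one_div_of_le (by norm_num) hn'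
  set g : ℕ → ℝ := fun k => f (k * h + h / 8 - h) with hg
  have hsum : ∑ i ∈ Finset.Icc 1 n, f (((i : ℝ) - 1) / n + 1 / (8 * n)) =
      ∑ k ∈ Finset.range n, g (k + 1) := by
    rw [Finset.range_eq_Ico, Finset.sum_Ico_add' g 0 n 1]
    refine Finset.sum_congr (by ext; simp) fun i _ => ?_
    simp only [hg]
    congr 1
    rw [hh]
    field_simp
    ring
  have hint : ∑ k ∈ Finset.range n, ∫ y in (k * h)..((k + 1 : ℕ) * h), f y = R := by
    rw [intervalIntegral.sum_integral_adjacent_intervals (a := fun k : ℕ => (k : ℝ) * h)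
      fun k _ => continuous_f.intervalIntegrable _ _, hnh]
    simpa using integral_f
  have hcell : ∀ k ∈ Finset.range n, h * (g (k + 1) + 3 / 8 * (g (k + 1) - g k)) ≤
      ∫ y in (k * h)..((k + 1 : ℕ) * h), f y := by
    intro k _
    convert le_integral_f hh0.le (k * h) using 2
    · have : g (k + 1) = f (k * h + h / 8) := by
        simp only [hg]; congr 1; push_cast; ring
      rw [this]
    · push_cast; ring
  have htotal := Finset.sum_le_sum hcell
  rw [hint, ← Finset.mul_sum, Finset.sum_add_distrib, ← Finset.mul_sum, Finset.sum_range_sub]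
    at htotal
  have hg0 : g 0 = 1 / 2 := if_pos (by push_cast; linarith [R_pos])
  have hgn : 1 / 2 + 2 / 39 < g n := lt_f_of_le (by linarith)
  have hlast : 1 / (52 * (n : ℝ)) = h / 52 := by rw [hh]; field_simp
  rw [hsum, F_one, hlast]
  nlinarith
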